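/- Let s be a string of length n and let 1 ≤ i ≤ j ≤ n. If the string s[i..j] occurs in s at some position i' with i' > i and i' + (j - i) ≤ n, then there exist integers ℓ ≥ 0 and r ≥ 0 with i - ℓ ≥ 1 and j + r ≤ n such that s[i-ℓ..j+r] is a closed repeat of s. -/

import Mathlib

/-- The substring `s[i..j]` of a (1-indexed) string `s` occurs at position `k`,
i.e. `s[k..k+(j-i)] = s[i..j]`. -/
def OccursAt {α : Type*} (s : ℕ → α) (i j k : ℕ) : Prop :=
  ∀ d : ℕ, d ≤ j - i → s (k + d) = s (i + d)

/-- `s[i'..i'+(j-i)]` is the next occurrence of the non-empty substring `s[i..j]`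
of a string `s` of length `n`: it is an occurrence with `i' > i`, it fits in the
string, and `s[i..j]` does not occur at any of the positions `i+1, ..., i'-1`. -/
def IsNextOcc {α : Type*} (s : ℕ → α) (n i j i' : ℕ) : Prop :=
  1 ≤ i ∧ i ≤ j ∧ j ≤ n ∧ i < i' ∧ i' + (j - i) ≤ n ∧ OccursAt s i j i' ∧
    ∀ k, i < k → k < i' → ¬ OccursAt s i j k

/-- `s[i..j]` is a right closed repeat of `s` (of length `n`) whose next
occurrence starts at position `i'`. -/
def IsRightClosedWith {α : Type*} (s : ℕ → α) (n i j i' : ℕ) : Prop :=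
  IsNextOcc s n i j i' ∧ (i' + (j - i) = n ∨ s (j + 1) ≠ s (i' + (j - i) + 1))

/-- `s[i..j]` is a left closed repeat of `s` (of length `n`) whose next
occurrence starts at position `i'`. -/
def IsLeftClosedWith {α : Type*} (s : ℕ → α) (n i j i' : ℕ) : Prop :=
  IsNextOcc s n i j i' ∧ (i = 1 ∨ s (i - 1) ≠ s (i' - 1))

/-- `s[i..j]` is a closed repeat of `s` (of length `n`) whose next occurrence
starts at position `i'`. -/
def IsClosedWith {α : Type*} (s : ℕ → α) (n i j i' : ℕ) : Prop :=
  IsRightClosedWith s n i j i' ∧ IsLeftClosedWith s n i j i'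

/-- `s[i..j]` is a right closed repeat of `s` of length `n`. -/
def IsRightClosedRepeat {α : Type*} (s : ℕ → α) (n i j : ℕ) : Prop :=
  ∃ i', IsRightClosedWith s n i j i'

/-- `s[i..j]` is a left closed repeat of `s` of length `n`. -/
def IsLeftClosedRepeat {α : Type*} (s : ℕ → α) (n i j : ℕ) : Prop :=
  ∃ i', IsLeftClosedWith s n i j i'

/-- `s[i..j]` is a closed repeat of `s` of length `n`. -/
def IsClosedRepeat {α : Type*} (s : ℕ → α) (n i j : ℕ) : Prop :=
  ∃ i', IsClosedWith s n i j i'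

/-- A repeat has a next occurrence. -/
theorem exists_isNextOcc {α : Type*} {s : ℕ → α} {n i j i' : ℕ}
    (hi : 1 ≤ i) (hij : i ≤ j) (hj : j ≤ n)
    (hii' : i < i') (hi'n : i' + (j - i) ≤ n) (hocc : OccursAt s i j i') :
    ∃ k, IsNextOcc s n i j k := by
  classical
  have hex : ∃ k, i < k ∧ OccursAt s i j k := ⟨i', hii', hocc⟩
  have hle : Nat.find hex ≤ i' := Nat.find_min' hex ⟨hii', hocc⟩
  obtain ⟨hlt, ho⟩ := Nat.find_spec hex
  exact ⟨Nat.find hex, hi, hij, hj, hlt, by omega, ho,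
    fun k hik hk hok => Nat.find_min hex hk ⟨hik, hok⟩⟩

/-- If the characters following two consecutive occurrences agree, then the extended
occurrences are consecutive as well. -/
theorem IsNextOcc.extend_right {α : Type*} {s : ℕ → α} {n i j i' : ℕ}
    (h : IsNextOcc s n i j i') (hn : i' + (j - i) ≠ n)
    (hs : s (j + 1) = s (i' + (j - i) + 1)) : IsNextOcc s n i (j + 1) i' := by
  obtain ⟨hi, hij, hj, hlt, hfit, ho, hno⟩ := h
  refine ⟨hi, by omega, by omega, hlt, by omega, fun d hd => ?_, fun k hik hk hok =>
    hno k hik hk fun d hd => hok d (by omega)⟩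
  rcases Nat.lt_or_ge (j - i) d with hd' | hd'
  · obtain rfl : d = j - i + 1 := by omega
    rw [show i + (j - i + 1) = j + 1 by omega, hs, Nat.add_assoc]
  · exact ho d hd'

/-- If the characters preceding two consecutive occurrences agree, then the extended
occurrences are consecutive as well. -/
theorem IsNextOcc.extend_left {α : Type*} {s : ℕ → α} {n i j i' : ℕ}
    (h : IsNextOcc s n i j i') (hi1 : i ≠ 1)
    (hs : s (i - 1) = s (i' - 1)) : IsNextOcc s n (i - 1) j (i' - 1) := by
  obtain ⟨hi, hij, hj, hlt, hfit, ho, hno⟩ := h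
  refine ⟨by omega, by omega, hj, by omega, by omega, fun d hd => ?_, fun k hik hk hok =>
    hno (k + 1) (by omega) (by omega) fun d hd => ?_⟩
  · rcases d with _ | d
    · exact hs.symm
    · rw [show i' - 1 + (d + 1) = i' + d by omega, show i - 1 + (d + 1) = i + d by omega]
      exact ho d (by omega)
  · have := hok (d + 1) (by omega)
    rwa [show k + (d + 1) = k + 1 + d by omega, show i - 1 + (d + 1) = i + d by omega] at this

/-- Every repeat extends to a closed repeat. -/
theorem IsNextOcc.exists_isClosedRepeat {α : Type*} {s : ℕ → α} {n i j i' : ℕ}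
    (h : IsNextOcc s n i j i') :
    ∃ a b, 1 ≤ a ∧ a ≤ i ∧ j ≤ b ∧ b ≤ n ∧ IsClosedRepeat s n a b := by
  induction hm : i + (n - j) using Nat.strong_induction_on generalizing i j i' with
  | _ m ih =>
    have ⟨hi, hij, hj, hlt, hfit, _⟩ := h
    by_cases hr : i' + (j - i) = n ∨ s (j + 1) ≠ s (i' + (j - i) + 1)
    · by_cases hl : i = 1 ∨ s (i - 1) ≠ s (i' - 1)
      · exact ⟨i, j, hi, le_rfl, le_rfl, hj, i', ⟨h, hr⟩, h, hl⟩
      · push Not at hl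
        obtain ⟨a, b, h1, h2, h3, h4, hc⟩ := ih _ (by omega) (h.extend_left hl.1 hl.2) rfl
        exact ⟨a, b, h1, by omega, h3, h4, hc⟩
    · push Not at hr
      obtain ⟨a, b, h1, h2, h3, h4, hc⟩ := ih _ (by omega) (h.extend_right hr.1 hr.2) rfl
      exact ⟨a, b, h1, h2, by omega, h4, hc⟩

/-- Every occurrence `s[i..j]` of a repeat, except the rightmost one, is
contained in some closed repeat `s[i-ℓ..j+r]`. -/
theorem statement9 {α : Type*} (s : ℕ → α) (n i j i' : ℕ)
    (hi : 1 ≤ i) (hij : i ≤ j) (hj : j ≤ n)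
    (hii' : i < i') (hi'n : i' + (j - i) ≤ n) (hocc : OccursAt s i j i') :
    ∃ l r : ℕ, 1 ≤ i - l ∧ j + r ≤ n ∧ IsClosedRepeat s n (i - l) (j + r) := by
  obtain ⟨k, hk⟩ := exists_isNextOcc hi hij hj hii' hi'n hocc
  obtain ⟨a, b, h1, h2, h3, h4, hc⟩ := hk.exists_isClosedRepeat
  have ha : i - (i - a) = a := by omega
  have hb : j + (b - j) = b := by omega
  exact ⟨i - a, b - j, by omega, by omega, by rwa [ha, hb]⟩
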